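/- arXiv:1604.01165 — 9 statements merged into one kernel-verified Lean document; each statement's English description precedes it below -/
import Mathlib

section
/- Let V be a finite-dimensional real vector space, A : V → V a linear map and π♯ : V* → V a skew linear map, and let Φ be the endomorphism of V × V* given by Φ(X, α) = (AX + π♯α, −A*α). Then Φ³ + Φ = 0 and Φ²({0} × V*) ⊆ {0} × V* hold if and only if A³ + A = 0, A ∘ π♯ = π♯ ∘ A*, and range π♯ ⊆ range A. (Algebraic content of Proposition 2.1: a quasi-classical generalized F structure is equivalent to a pair (A, π) with A an F structure, π_A again a bivector, and im ♯π ⊆ im A.) -/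
/-- The endomorphism `Φ(X, α) = (AX + π♯α, −A*α)` of `V × V*` defined by a pair
`(A : V → V, π♯ : V* → V)`. -/
def Phi {K : Type*} [Field K] {V : Type*} [AddCommGroup V] [Module K V]
    (A : V →ₗ[K] V) (p : Module.Dual K V →ₗ[K] V) :
    (V × Module.Dual K V) →ₗ[K] (V × Module.Dual K V) :=
  LinearMap.prod
    (A ∘ₗ LinearMap.fst K V (Module.Dual K V) + p ∘ₗ LinearMap.snd K V (Module.Dual K V))
    (-(A.dualMap ∘ₗ LinearMap.snd K V (Module.Dual K V)))

theorem Phi_apply {K : Type*} [Field K] {V : Type*} [AddCommGroup V] [Module K V]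
    (A : V →ₗ[K] V) (p : Module.Dual K V →ₗ[K] V) (X : V) (α : Module.Dual K V) :
    Phi A p (X, α) = (A X + p α, -A.dualMap α) := rfl

/-- Algebraic content of Proposition 2.1: `Φ³ + Φ = 0` together with
`Φ²({0} × V*) ⊆ {0} × V*` holds iff `A³ + A = 0`, `A ∘ π♯ = π♯ ∘ A*` and
`range π♯ ⊆ range A`. -/
theorem quasi_classical_F_iff {V : Type*} [AddCommGroup V] [Module ℝ V]
    [FiniteDimensional ℝ V] (A : V →ₗ[ℝ] V) (p : Module.Dual ℝ V →ₗ[ℝ] V)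
    (hskew : ∀ α β : Module.Dual ℝ V, α (p β) = - β (p α)) :
    (Phi A p ∘ₗ Phi A p ∘ₗ Phi A p + Phi A p = 0 ∧
      ∀ α : Module.Dual ℝ V, ((Phi A p ∘ₗ Phi A p) (0, α)).1 = 0) ↔
    (A ∘ₗ A ∘ₗ A + A = 0 ∧ A ∘ₗ p = p ∘ₗ A.dualMap ∧
      LinearMap.range p ≤ LinearMap.range A) := by
  constructor
  · rintro ⟨hF, hV⟩
    have hcomm : ∀ α, A (p α) = p (A.dualMap α) := fun α => by
      have h := hV α
      simp only [LinearMap.comp_apply, Phi_apply, map_zero, zero_add, map_neg,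
        ← sub_eq_add_neg] at h
      exact sub_eq_zero.mp h
    refine ⟨?_, LinearMap.ext hcomm, ?_⟩
    · ext X
      have h := congrArg Prod.fst (LinearMap.congr_fun hF (X, 0))
      simpa [Phi_apply] using h
    · rintro _ ⟨α, rfl⟩
      have h := congrArg Prod.fst (LinearMap.congr_fun hF (0, α))
      simp only [LinearMap.add_apply, LinearMap.comp_apply, Phi_apply, map_zero, zero_add,
        map_neg, neg_neg, Prod.mk_add_mk, LinearMap.zero_apply, Prod.fst_zero, hcomm,
        add_neg_cancel] at h
      refine ⟨-p (A.dualMap α), ?_⟩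
      rw [map_neg, hcomm]
      exact neg_eq_of_add_eq_zero_right h
  · rintro ⟨hA, hcomm, hrange⟩
    replace hcomm : ∀ α, A (p α) = p (A.dualMap α) := LinearMap.congr_fun hcomm
    have hA' : ∀ X, A (A (A X)) + A X = 0 := LinearMap.congr_fun hA
    have hp : ∀ α, p (A.dualMap (A.dualMap α)) + p α = 0 := fun α => by
      obtain ⟨Y, hY⟩ := hrange ⟨α, rfl⟩
      rw [← hcomm, ← hcomm, ← hY]
      exact hA' Y
    have hdual : ∀ α, A.dualMap (A.dualMap (A.dualMap α)) + A.dualMap α = 0 := fun α => by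
      ext X
      simp only [LinearMap.add_apply, LinearMap.dualMap_apply, LinearMap.zero_apply]
      rw [← map_add, hA', map_zero]
    refine ⟨LinearMap.ext fun ⟨X, α⟩ => ?_, fun α => ?_⟩
    · simp only [LinearMap.add_apply, LinearMap.comp_apply, Phi_apply, map_add, map_neg,
        neg_neg, Prod.mk_add_mk, LinearMap.zero_apply, hcomm, Prod.mk_eq_zero]
      constructor
      · rw [add_neg_cancel_right, add_add_add_comm, hA', hp, add_zero]
      · rw [← neg_add, hdual, neg_zero]
    · simp [LinearMap.comp_apply, Phi_apply, hcomm]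
end

section
/- Let V be a real vector space and A : V → V a linear map with A³ + A = 0. Then the range of A* ∘ A* + id_{V*} equals the annihilator ann(range A) of the range of A. (The identity im(A*² + Id) = ann P used in the proof of Proposition 2.1.) -/
/-- The identity `im(A*² + Id) = ann(im A)` for an F structure `A` (`A³ + A = 0`). -/
theorem range_dual_sq_add_id {V : Type*} [AddCommGroup V] [Module ℝ V]
    (A : V →ₗ[ℝ] V) (hA : A ∘ₗ A ∘ₗ A + A = 0) :
    LinearMap.range (A.dualMap ∘ₗ A.dualMap + LinearMap.id) =
      (LinearMap.range A).dualAnnihilator := by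
  ext φ
  rw [Submodule.mem_dualAnnihilator]
  constructor
  · rintro ⟨ψ, rfl⟩ _ ⟨x, rfl⟩
    have h : A (A (A x)) + A x = 0 := LinearMap.congr_fun hA x
    change ψ (A (A (A x))) + ψ (A x) = 0
    rw [← map_add, h, map_zero]
  · intro h
    refine ⟨φ, LinearMap.ext fun x => ?_⟩
    change φ (A (A x)) + φ x = φ x
    rw [h _ (LinearMap.mem_range_self A (A x)), zero_add]
end

section
/- Let V be a finite-dimensional complex vector space, A : V → V ℂ-linear with A³ + A = 0, and π♯ : V* → V a skew linear map with A ∘ π♯ = π♯ ∘ A* and range π♯ ⊆ range A. Then: π♯ maps ker(A* − i·id) into ker(A − i·id), π♯ maps ker(A* + i·id) into ker(A + i·id), π♯ vanishes on ker A*, and β(π♯α) = 0 whenever A*α = iα and A*β = −iβ. In particular, the bivector π(α, β) = β(π♯α) can be nonzero only when both arguments lie in ker(A* − i·id) or both lie in ker(A* + i·id). (Proposition 2.2: the local expression (2.7) of π has only H∧H and H̄∧H̄ components.) -/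
/-- Proposition 2.2: for a quasi-classical pair `(A, π♯)` on a finite-dimensional
complex space (`A³ + A = 0`, `π♯` skew, `A ∘ π♯ = π♯ ∘ A*`, `range π♯ ⊆ range A`),
the map `π♯` sends `ker(A* − i)` into `ker(A − i)`, sends `ker(A* + i)` into
`ker(A + i)`, vanishes on `ker A*`, and `β(π♯α) = 0` whenever `A*α = iα` and
`A*β = −iβ`. -/
theorem pi_local_structure {V : Type*} [AddCommGroup V] [Module ℂ V]
    [FiniteDimensional ℂ V] (A : V →ₗ[ℂ] V) (p : Module.Dual ℂ V →ₗ[ℂ] V)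
    (hA : A ∘ₗ A ∘ₗ A + A = 0)
    (hskew : ∀ α β : Module.Dual ℂ V, α (p β) = - β (p α))
    (hcomm : A ∘ₗ p = p ∘ₗ A.dualMap)
    (hrange : LinearMap.range p ≤ LinearMap.range A) :
    (∀ α : Module.Dual ℂ V, A.dualMap α = Complex.I • α → A (p α) = Complex.I • p α) ∧
    (∀ α : Module.Dual ℂ V, A.dualMap α = -Complex.I • α → A (p α) = -Complex.I • p α) ∧
    (∀ α : Module.Dual ℂ V, A.dualMap α = 0 → p α = 0) ∧
    (∀ α β : Module.Dual ℂ V, A.dualMap α = Complex.I • α →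
      A.dualMap β = -Complex.I • β → β (p α) = 0) := by
  have comm : ∀ α, A (p α) = p (A.dualMap α) := fun α => LinearMap.congr_fun hcomm α
  refine ⟨fun α h => by rw [comm, h, map_smul], fun α h => by rw [comm, h, map_smul],
    fun α h => ?_, fun α β hα hβ => ?_⟩
  · obtain ⟨v, hv⟩ := hrange (LinearMap.mem_range_self p α)
    have hAp : A (p α) = 0 := by rw [comm, h, map_zero]
    have hcube : A (A (A v)) + A v = 0 := LinearMap.congr_fun hA v
    rwa [hv, hAp, map_zero, zero_add] at hcube
  · have h₁ : β (A (p α)) = Complex.I * β (p α) := by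
      rw [comm, hα, map_smul, map_smul, smul_eq_mul]
    have h₂ : β (A (p α)) = -Complex.I * β (p α) := LinearMap.congr_fun hβ (p α)
    have h₃ : Complex.I * β (p α) = 0 := by linear_combination (h₂ - h₁) / 2
    exact (mul_eq_zero.mp h₃).resolve_left Complex.I_ne_zero
end

section
/- Let V be a complex vector space, A : V → V ℂ-linear with A³ + A = 0, and π♯ : V* → V a linear map with A ∘ π♯ = π♯ ∘ A*. Let Φ be the endomorphism of V × V* given by Φ(X, α) = (AX + π♯α, −A*α). Then the i-eigenspace of Φ is exactly { (Z − (i/2)·π♯ξ, ξ) : Z ∈ ker(A − i·id), ξ ∈ ker(A* + i·id) }. (Proposition 2.3: the eigenspace E of the quasi-classical generalized F structure, in the form E = {(Z + c·π♯ξ, ξ) with Z ∈ H, ξ ∈ ann(H ⊕ Q)}.) -/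
/-- Proposition 2.3: the `i`-eigenspace of `Φ` is
`E = {(Z − (i/2)π♯ξ, ξ) : Z ∈ ker(A − i·id), ξ ∈ ker(A* + i·id)}`. -/
theorem eigenspace_E {V : Type*} [AddCommGroup V] [Module ℂ V]
    (A : V →ₗ[ℂ] V) (p : Module.Dual ℂ V →ₗ[ℂ] V)
    (hA : A ∘ₗ A ∘ₗ A + A = 0)
    (hcomm : A ∘ₗ p = p ∘ₗ A.dualMap) :
    {u : V × Module.Dual ℂ V | Phi A p u = Complex.I • u} =
    {u : V × Module.Dual ℂ V | ∃ (Z : V) (ξ : Module.Dual ℂ V),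
      A Z = Complex.I • Z ∧ A.dualMap ξ = -Complex.I • ξ ∧
      u = (Z - (Complex.I / 2) • p ξ, ξ)} := by
  have hAp (ξ : Module.Dual ℂ V) (hξ : A.dualMap ξ = -Complex.I • ξ) :
      A (p ξ) = -Complex.I • p ξ := by
    rw [← LinearMap.comp_apply, hcomm, LinearMap.comp_apply, hξ, map_smul]
  have hPhi (X : V) (ξ : Module.Dual ℂ V) : Phi A p (X, ξ) = Complex.I • (X, ξ) ↔
      A X + p ξ = Complex.I • X ∧ A.dualMap ξ = -Complex.I • ξ := by
    rw [neg_smul, ← neg_eq_iff_eq_neg]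
    exact Prod.ext_iff
  ext ⟨X, ξ⟩
  rw [Set.mem_ofPred_eq, Set.mem_ofPred_eq, hPhi]
  constructor
  · rintro ⟨hX, hξ⟩
    refine ⟨X + (Complex.I / 2) • p ξ, ξ, ?_, hξ, by simp⟩
    rw [map_add, map_smul, hAp ξ hξ, eq_sub_of_add_eq hX]
    match_scalars
    · ring
    · linear_combination -Complex.I_sq
  · rintro ⟨Z, η, hZ, hη, h⟩
    obtain ⟨rfl, rfl⟩ := Prod.mk.inj h
    refine ⟨?_, hη⟩
    rw [map_sub, map_smul, hAp _ hη, hZ]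
    match_scalars
    · ring
    · linear_combination Complex.I_sq
end

section
/- Let L be a complex Lie algebra and A : L → L a ℂ-linear map with A³ + A = 0. Then S_A(X, Y) = 0 for all X, Y ∈ L if and only if both H = ker(A − i·id) and H̄ = ker(A + i·id) are closed under the Lie bracket, i.e., [H, H] ⊆ H and [H̄, H̄] ⊆ H̄. (The equivalence of the CR-type condition (1.10) with involutivity of the eigenspaces.) -/
/-- The CR-type condition (1.10): for a ℂ-linear F structure `A` (`A³ + A = 0`) on a
complex Lie algebra `L`, `S_A = 0` iff both eigenspaces `H = ker(A − i·id)` and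
`H̄ = ker(A + i·id)` are closed under the Lie bracket. -/
theorem SA_eq_zero_iff_involutive {L : Type*} [LieRing L] [LieAlgebra ℂ L]
    (A : L →ₗ[ℂ] L) (hA : A ∘ₗ A ∘ₗ A + A = 0)
    (H Hb : Submodule ℂ L)
    (hH : H = LinearMap.ker (A - Complex.I • LinearMap.id))
    (hHb : Hb = LinearMap.ker (A + Complex.I • LinearMap.id)) :
    (∀ X Y : L,
      ⁅A X, A Y⁆ + A ⁅A X, A (A Y)⁆ + A ⁅A (A X), A Y⁆ - ⁅A (A X), A (A Y)⁆ = 0) ↔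
    ((∀ X ∈ H, ∀ Y ∈ H, ⁅X, Y⁆ ∈ H) ∧ (∀ X ∈ Hb, ∀ Y ∈ Hb, ⁅X, Y⁆ ∈ Hb)) := by
  have hA3 (X : L) : A (A (A X)) = -A X := by
    simpa [add_eq_zero_iff_eq_neg] using LinearMap.congr_fun hA X
  have memH (X : L) : X ∈ H ↔ A X = Complex.I • X := by simp [hH, sub_eq_zero]
  have memHb (X : L) : X ∈ Hb ↔ A X = -(Complex.I • X) := by
    simp [hHb, add_eq_zero_iff_eq_neg]
  constructor
  · intro h
    constructor
    · intro X hX Y hY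
      rw [memH] at *
      have hS := h X Y
      simp only [hX, hY, map_smul, smul_lie, lie_smul, smul_smul,
        Complex.I_mul_I] at hS
      linear_combination (norm := module) (Complex.I / 2) • hS
        + Complex.I_mul_I • A ⁅X, Y⁆
    · intro X hX Y hY
      rw [memHb] at *
      have hS := h X Y
      simp only [hX, hY, map_smul, map_neg, smul_lie, lie_smul, neg_lie, lie_neg, smul_neg,
        smul_smul, Complex.I_mul_I] at hS
      linear_combination (norm := module) (-Complex.I / 2) • hS
        + Complex.I_mul_I • A ⁅X, Y⁆
  · rintro ⟨h, hb⟩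
    -- `A X = U + V` and `A² X = i (U - V)` with `U ∈ H` and `V ∈ H̄`.
    have decomp (X : L) : ∃ U ∈ H, ∃ V ∈ Hb,
        A X = U + V ∧ A (A X) = Complex.I • U - Complex.I • V := by
      refine ⟨(1 / 2 : ℂ) • (A X - Complex.I • A (A X)), ?_,
        (1 / 2 : ℂ) • (A X + Complex.I • A (A X)), ?_, by module, ?_⟩
      · rw [memH]
        simp only [map_smul, map_sub, hA3]
        linear_combination (norm := module) (1 / 2 : ℂ) • Complex.I_mul_I • A (A X)
      · rw [memHb]
        simp only [map_smul, map_add, hA3]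
        linear_combination (norm := module) (1 / 2 : ℂ) • Complex.I_mul_I • A (A X)
      · linear_combination (norm := module) Complex.I_mul_I • A (A X)
    intro X Y
    obtain ⟨U, hU, V, hV, hX, hX2⟩ := decomp X
    obtain ⟨U', hU', V', hV', hY, hY2⟩ := decomp Y
    have hUU := (memH _).1 (h U hU U' hU')
    have hVV := (memHb _).1 (hb V hV V' hV')
    rw [hX2, hY2, hX, hY]
    simp only [add_lie, lie_add, sub_lie, lie_sub, smul_lie, lie_smul, map_add, map_sub, map_smul,
      hUU, hVV, smul_sub, smul_add, smul_smul, smul_neg, Complex.I_mul_I]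
    module
end

section
/- Let L be a complex Lie algebra and A : L → L a ℂ-linear map with A³ + A = 0, with H = ker(A − i·id), H̄ = ker(A + i·id), Q = ker A, P = range A. Then the conjunction of (i) N_A(X, Y) = (A² + id)[X, Y] for all X, Y ∈ P and (ii) N_A(X, Y) = 0 for all X ∈ P, Y ∈ Q is equivalent to the conjunction of [H, H] ⊆ H, [H̄, H̄] ⊆ H̄, and A²[X, Y] = A[AX, Y] for all X ∈ P, Y ∈ Q. (Remark 2.2: A is a classical CRF structure iff H, H̄ are involutive and (2.9) holds.) -/
/-- Remark 2.2: `A` is a classical CRF structure (conditions (1.12)) iff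
`H` and `H̄` are involutive and `A²[X, Y] = A[AX, Y]` for `X ∈ P`, `Y ∈ Q`. -/
theorem classical_CRF_iff {L : Type*} [LieRing L] [LieAlgebra ℂ L]
    (A : L →ₗ[ℂ] L) (hA : A ∘ₗ A ∘ₗ A + A = 0)
    (H Hb Q P : Submodule ℂ L)
    (hH : H = LinearMap.ker (A - Complex.I • LinearMap.id))
    (hHb : Hb = LinearMap.ker (A + Complex.I • LinearMap.id))
    (hQ : Q = LinearMap.ker A) (hP : P = LinearMap.range A)
    (N : L → L → L)
    (hN : ∀ X Y : L, N X Y = ⁅A X, A Y⁆ - A ⁅A X, Y⁆ - A ⁅X, A Y⁆ + A (A ⁅X, Y⁆)) :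
    ((∀ X ∈ P, ∀ Y ∈ P, N X Y = A (A ⁅X, Y⁆) + ⁅X, Y⁆) ∧
      (∀ X ∈ P, ∀ Y ∈ Q, N X Y = 0)) ↔
    ((∀ X ∈ H, ∀ Y ∈ H, ⁅X, Y⁆ ∈ H) ∧ (∀ X ∈ Hb, ∀ Y ∈ Hb, ⁅X, Y⁆ ∈ Hb) ∧
      (∀ X ∈ P, ∀ Y ∈ Q, A (A ⁅X, Y⁆) = A ⁅A X, Y⁆)) := by
  subst hH hHb hQ hP
  have hA3 (x : L) : A (A (A x)) = -A x :=
    eq_neg_of_add_eq_zero_left (by simpa using LinearMap.congr_fun hA x)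
  have hI : Complex.I * Complex.I = -1 := Complex.I_mul_I
  have memH (x : L) : x ∈ LinearMap.ker (A - Complex.I • LinearMap.id) ↔
      A x = Complex.I • x := by
    simp [sub_eq_zero]
  have memHb (x : L) : x ∈ LinearMap.ker (A + Complex.I • LinearMap.id) ↔
      A x = -(Complex.I • x) := by
    simp [add_eq_zero_iff_eq_neg]
  have sq_range {x : L} (hx : x ∈ LinearMap.range A) : A (A x) = -x := by
    obtain ⟨z, rfl⟩ := hx
    exact hA3 z
  simp only [memH, memHb, hN]
  have hPQ : (∀ X ∈ LinearMap.range A, ∀ Y ∈ LinearMap.ker A,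
        ⁅A X, A Y⁆ - A ⁅A X, Y⁆ - A ⁅X, A Y⁆ + A (A ⁅X, Y⁆) = 0) ↔
      ∀ X ∈ LinearMap.range A, ∀ Y ∈ LinearMap.ker A, A (A ⁅X, Y⁆) = A ⁅A X, Y⁆ := by
    refine forall₂_congr fun X _ => forall₂_congr fun Y hY => ?_
    rw [LinearMap.mem_ker.mp hY, lie_zero, lie_zero, map_zero, zero_sub, sub_zero,
      neg_add_eq_zero, eq_comm]
  rw [hPQ, ← and_assoc]
  refine and_congr_left fun _ => ⟨fun h => ⟨fun X hX Y hY => ?_, fun X hX Y hY => ?_⟩, ?_⟩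
  · have hr {x : L} (hx : A x = Complex.I • x) : x ∈ LinearMap.range A :=
      ⟨-Complex.I • x, by rw [map_smul, hx, smul_smul, neg_mul, hI, neg_neg, one_smul]⟩
    have e := h X (hr hX) Y (hr hY)
    simp only [hX, hY, smul_lie, lie_smul, map_smul] at e
    linear_combination (norm := (match_scalars <;> grind)) (Complex.I / 2) • e
  · have hr {x : L} (hx : A x = -(Complex.I • x)) : x ∈ LinearMap.range A :=
      ⟨Complex.I • x, by rw [map_smul, hx, smul_neg, smul_smul, hI, neg_smul, neg_neg, one_smul]⟩
    have e := h X (hr hX) Y (hr hY)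
    simp only [hX, hY, neg_lie, lie_neg, map_neg, smul_lie, lie_smul, map_smul] at e
    linear_combination (norm := (match_scalars <;> grind)) (-Complex.I / 2) • e
  · rintro ⟨hH, hHb⟩ X hX Y hY
    have projH {x : L} (hx : x ∈ LinearMap.range A) :
        A (x - Complex.I • A x) = Complex.I • (x - Complex.I • A x) := by
      rw [map_sub, map_smul, sq_range hx, smul_sub, smul_smul, hI]
      module
    have projHb {x : L} (hx : x ∈ LinearMap.range A) :
        A (x + Complex.I • A x) = -(Complex.I • (x + Complex.I • A x)) := by
      rw [map_add, map_smul, sq_range hx, smul_add, smul_smul, hI]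
      module
    have e₁ := hH _ (projH hX) _ (projH hY)
    have e₂ := hHb _ (projHb hX) _ (projHb hY)
    simp only [sub_lie, lie_sub, add_lie, lie_add, smul_lie, lie_smul, map_sub, map_add,
      map_smul, smul_add, smul_sub, smul_smul, hI] at e₁ e₂
    linear_combination (norm := (match_scalars <;> grind))
      (Complex.I / 2) • e₂ - (Complex.I / 2) • e₁
end

section
/- Let L be a complex Lie algebra and A : L → L a ℂ-linear map with A³ + A = 0, with H = ker(A − i·id), H̄ = ker(A + i·id), Q = ker A, P = range A. Then N_A(X, Y) = 0 for all X ∈ P and Y ∈ Q if and only if [H, Q] ⊆ H + Q and [H̄, Q] ⊆ H̄ + Q. (The second condition of (1.12), equivalently the second condition of (1.11) together with its conjugate.) -/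
theorem LinearMap.mem_ker_sub_smul_id_sup_ker_iff {K V : Type*} [Field K] [AddCommGroup V]
    [Module K V] (A : V →ₗ[K] V) {c : K} (hc : c ≠ 0) (z : V) :
    z ∈ LinearMap.ker (A - c • LinearMap.id) ⊔ LinearMap.ker A ↔ A (A z) = c • A z := by
  rw [Submodule.mem_sup]
  constructor
  · rintro ⟨h, hh, q, hq, rfl⟩
    have hh' : A h = c • h := by simpa [sub_eq_zero] using hh
    have hq' : A q = 0 := hq
    simp [hh', hq']
  · intro hz
    refine ⟨c⁻¹ • A z, ?_, z - c⁻¹ • A z, ?_, by abel⟩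
    · simp [hz]
    · simp [hz, hc]

/-- The second condition of (1.12): `N_A(X, Y) = 0` for all `X ∈ P`, `Y ∈ Q`
iff `[H, Q] ⊆ H + Q` and `[H̄, Q] ⊆ H̄ + Q`. -/
theorem NA_PQ_iff {L : Type*} [LieRing L] [LieAlgebra ℂ L]
    (A : L →ₗ[ℂ] L) (hA : A ∘ₗ A ∘ₗ A + A = 0)
    (H Hb Q P : Submodule ℂ L)
    (hH : H = LinearMap.ker (A - Complex.I • LinearMap.id))
    (hHb : Hb = LinearMap.ker (A + Complex.I • LinearMap.id))
    (hQ : Q = LinearMap.ker A) (hP : P = LinearMap.range A)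
    (N : L → L → L)
    (hN : ∀ X Y : L, N X Y = ⁅A X, A Y⁆ - A ⁅A X, Y⁆ - A ⁅X, A Y⁆ + A (A ⁅X, Y⁆)) :
    (∀ X ∈ P, ∀ Y ∈ Q, N X Y = 0) ↔
    ((∀ X ∈ H, ∀ Y ∈ Q, ⁅X, Y⁆ ∈ H ⊔ Q) ∧ (∀ X ∈ Hb, ∀ Y ∈ Q, ⁅X, Y⁆ ∈ Hb ⊔ Q)) := by
  subst hH hHb hQ hP
  have hA3 (x : L) : A (A (A x)) = -A x :=
    eq_neg_of_add_eq_zero_left (by simpa using LinearMap.congr_fun hA x)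
  have hNQ (X Y : L) (hY : Y ∈ LinearMap.ker A) : N X Y = A (A ⁅X, Y⁆) - A ⁅A X, Y⁆ := by
    have hY' : A Y = 0 := hY
    rw [hN, hY']
    simp only [lie_zero, map_zero]
    abel
  have hneg : A + Complex.I • LinearMap.id = A - (-Complex.I) • LinearMap.id := by
    rw [neg_smul, sub_neg_eq_add]
  have eigen_iff (c : ℂ) (hc : c ≠ 0) (X Y : L) (hX : A X = c • X) (hY : Y ∈ LinearMap.ker A) :
      N X Y = 0 ↔ ⁅X, Y⁆ ∈ LinearMap.ker (A - c • LinearMap.id) ⊔ LinearMap.ker A := by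
    rw [LinearMap.mem_ker_sub_smul_id_sup_ker_iff A hc, hNQ X Y hY, hX, smul_lie, map_smul,
      sub_eq_zero]
  have eigen_of_mem (c : ℂ) (X : L) (hX : X ∈ LinearMap.ker (A - c • LinearMap.id)) :
      A X = c • X := by
    simpa [sub_eq_zero] using hX
  have mem_range (c : ℂ) (hc : c ≠ 0) (X : L) (hX : A X = c • X) : X ∈ LinearMap.range A :=
    ⟨c⁻¹ • X, by simp [hX, hc]⟩
  have hI : Complex.I ≠ 0 := Complex.I_ne_zero
  rw [hneg]
  constructor
  · intro h
    refine ⟨fun X hX Y hY => ?_, fun X hX Y hY => ?_⟩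
    · have hX' := eigen_of_mem _ X hX
      exact (eigen_iff _ hI X Y hX' hY).1 (h X (mem_range _ hI X hX') Y hY)
    · have hX' := eigen_of_mem _ X hX
      exact (eigen_iff _ (neg_ne_zero.2 hI) X Y hX' hY).1
        (h X (mem_range _ (neg_ne_zero.2 hI) X hX') Y hY)
  · rintro ⟨h₁, h₂⟩ X ⟨W, rfl⟩ Y hY
    have hu : A (A (A W) + Complex.I • A W) = Complex.I • (A (A W) + Complex.I • A W) := by
      rw [map_add, map_smul, hA3, smul_add, smul_smul, Complex.I_mul_I, neg_one_smul, add_comm]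
    have hv : A (A (A W) - Complex.I • A W) = (-Complex.I) • (A (A W) - Complex.I • A W) := by
      rw [map_sub, map_smul, hA3, smul_sub, smul_smul, neg_mul, Complex.I_mul_I, neg_neg, one_smul,
        neg_smul]
      abel
    have hNu := (eigen_iff _ hI _ Y hu hY).2 (h₁ _ (by simp [hu, -map_add]) Y hY)
    have hNv := (eigen_iff _ (neg_ne_zero.2 hI) _ Y hv hY).2
      (h₂ _ (by rw [LinearMap.mem_ker, LinearMap.sub_apply, hv]; simp) Y hY)
    have hsub : N (A (A W) + Complex.I • A W) Y - N (A (A W) - Complex.I • A W) Y =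
        (2 * Complex.I) • N (A W) Y := by
      simp only [hNQ _ Y hY, map_add, map_sub, map_smul, add_lie, sub_lie, smul_lie]
      module
    rw [hNu, hNv, sub_zero] at hsub
    exact (smul_eq_zero.1 hsub.symm).resolve_left (mul_ne_zero two_ne_zero hI)
end

section
/- Let L be a complex Lie algebra and A : L → L a ℂ-linear map with A³ + A = 0, with H = ker(A − i·id), H̄ = ker(A + i·id), P = range A. Then N_A(X, Y) = (A² + id)[X, Y] for all X, Y ∈ P if and only if [H, H] ⊆ H and [H̄, H̄] ⊆ H̄. (Remark 2.2: the first condition of (1.12) is equivalent to involutivity of the ±i-eigenspaces.) -/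
section Eigenvectors

variable {L : Type*} [LieRing L] [LieAlgebra ℂ L] (A : L →ₗ[ℂ] L) {c : ℂ}

lemma mem_range_of_map_eq_smul (hc : c ≠ 0) {X : L} (hX : A X = c • X) :
    X ∈ LinearMap.range A :=
  ⟨c⁻¹ • X, by rw [map_smul, hX, inv_smul_smul₀ hc]⟩

lemma map_sub_smul_map (hc : c * c = -1) {X : L} (hX : A (A X) = -X) :
    A (X - c • A X) = c • (X - c • A X) := by
  rw [map_sub, map_smul, hX, smul_sub, smul_smul, hc]
  module

lemma map_lie_of_nijenhuis_eq (hc : c * c = -1) {X Y : L} (hX : A X = c • X) (hY : A Y = c • Y)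
    (h : ⁅A X, A Y⁆ - A ⁅A X, Y⁆ - A ⁅X, A Y⁆ + A (A ⁅X, Y⁆) = A (A ⁅X, Y⁆) + ⁅X, Y⁆) :
    A ⁅X, Y⁆ = c • ⁅X, Y⁆ := by
  simp only [hX, hY, smul_lie, lie_smul, map_smul, smul_smul, hc] at h
  have h' : c • A ⁅X, Y⁆ = -⁅X, Y⁆ := by
    linear_combination (norm := module) (-1 / 2 : ℂ) • h
  have := congrArg (c • ·) h'
  simp only [smul_smul, hc] at this
  linear_combination (norm := module) (-1 : ℂ) • this

end Eigenvectors


/-- Remark 2.2: the first condition of (1.12), `N_A(X, Y) = (A² + id)[X, Y]` for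
`X, Y ∈ P`, is equivalent to involutivity of the `±i`-eigenspaces. -/
theorem NA_PP_iff {L : Type*} [LieRing L] [LieAlgebra ℂ L]
    (A : L →ₗ[ℂ] L) (hA : A ∘ₗ A ∘ₗ A + A = 0)
    (H Hb P : Submodule ℂ L)
    (hH : H = LinearMap.ker (A - Complex.I • LinearMap.id))
    (hHb : Hb = LinearMap.ker (A + Complex.I • LinearMap.id))
    (hP : P = LinearMap.range A)
    (N : L → L → L)
    (hN : ∀ X Y : L, N X Y = ⁅A X, A Y⁆ - A ⁅A X, Y⁆ - A ⁅X, A Y⁆ + A (A ⁅X, Y⁆)) :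
    (∀ X ∈ P, ∀ Y ∈ P, N X Y = A (A ⁅X, Y⁆) + ⁅X, Y⁆) ↔
    ((∀ X ∈ H, ∀ Y ∈ H, ⁅X, Y⁆ ∈ H) ∧ (∀ X ∈ Hb, ∀ Y ∈ Hb, ⁅X, Y⁆ ∈ Hb)) := by
  subst hH hHb hP
  have hH (X : L) : X ∈ LinearMap.ker (A - Complex.I • LinearMap.id) ↔ A X = Complex.I • X := by
    simp [sub_eq_zero]
  have hHb (X : L) :
      X ∈ LinearMap.ker (A + Complex.I • LinearMap.id) ↔ A X = -Complex.I • X := by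
    simp [add_eq_zero_iff_eq_neg]
  have hI : Complex.I * Complex.I = -1 := Complex.I_mul_I
  simp only [hH, hHb, hN]
  constructor
  · intro h
    exact ⟨fun X hX Y hY ↦ map_lie_of_nijenhuis_eq A hI hX hY
        (h X (mem_range_of_map_eq_smul A Complex.I_ne_zero hX)
          Y (mem_range_of_map_eq_smul A Complex.I_ne_zero hY)),
      fun X hX Y hY ↦ map_lie_of_nijenhuis_eq A (by simp) hX hY
        (h X (mem_range_of_map_eq_smul A (neg_ne_zero.2 Complex.I_ne_zero) hX)
          Y (mem_range_of_map_eq_smul A (neg_ne_zero.2 Complex.I_ne_zero) hY))⟩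
  · rintro ⟨h₁, h₂⟩ X hX Y hY
    have hsq {X : L} (hX : X ∈ LinearMap.range A) : A (A X) = -X := by
      obtain ⟨Z, rfl⟩ := hX
      exact eq_neg_of_add_eq_zero_left (by simpa using LinearMap.congr_fun hA Z)
    have e₁ := h₁ _ (map_sub_smul_map A hI (hsq hX)) _ (map_sub_smul_map A hI (hsq hY))
    have e₂ := h₂ _ (map_sub_smul_map A (c := -Complex.I) (by simp) (hsq hX))
      _ (map_sub_smul_map A (c := -Complex.I) (by simp) (hsq hY))
    simp only [lie_sub, sub_lie, lie_smul, smul_lie, map_sub, map_smul, smul_sub, smul_smul,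
      neg_mul, mul_neg, neg_neg, hI] at e₁ e₂
    refine smul_right_injective L Complex.I_ne_zero ?_
    linear_combination (norm := module) (1 / 2 : ℂ) • e₁ - (1 / 2 : ℂ) • e₂
end

section
/- Let V be a real vector space, A : V → V linear, Z_1, …, Z_h ∈ V, ξ¹, …, ξ^h ∈ V*, and π♯ : V* → V a skew linear map, satisfying: β(π♯(A*α)) = (A*β)(π♯α) for all α, β ∈ V* (i.e., π(α∘A, β) = π(α, β∘A)); A Z_a = 0 and A*ξ^a = 0 and π♯ξ^a = 0 for all a; ξ^a(Z_b) = δ^a_b; and A²X = −X + Σ_a ξ^a(X) Z_a for all X ∈ V. Then A³ + A = 0, A ∘ π♯ = π♯ ∘ A*, range π♯ ⊆ range A, range A = ∩_a ker ξ^a, and ker A = span{Z_1, …, Z_h}; consequently the endomorphism Φ(X, α) = (AX + π♯α, −A*α) of V × V* satisfies Φ³ + Φ = 0. (The claim that a generalized almost contact structure of codimension h with σ = 0 yields a quasi-classical generalized F structure.) -/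
/-- A generalized almost contact structure of codimension `h` with `σ = 0`
(conditions (3.1)) yields a quasi-classical generalized F structure: `A³ + A = 0`,
`A ∘ π♯ = π♯ ∘ A*`, `range π♯ ⊆ range A = ∩ₐ ker ξᵃ`, `ker A = span{Zₐ}`, and
`Φ³ + Φ = 0`. -/
theorem almost_contact_quasi_classical {V : Type*} [AddCommGroup V] [Module ℝ V]
    {h : ℕ} (A : V →ₗ[ℝ] V) (Z : Fin h → V) (ξ : Fin h → Module.Dual ℝ V)
    (p : Module.Dual ℝ V →ₗ[ℝ] V)
    (hskew : ∀ α β : Module.Dual ℝ V, α (p β) = - β (p α))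
    (hπA : ∀ α β : Module.Dual ℝ V, β (p (A.dualMap α)) = (A.dualMap β) (p α))
    (hAZ : ∀ a, A (Z a) = 0)
    (hAξ : ∀ a, A.dualMap (ξ a) = 0)
    (hpξ : ∀ a, p (ξ a) = 0)
    (hδ : ∀ a b, ξ a (Z b) = if a = b then 1 else 0)
    (hA2 : ∀ X : V, A (A X) = -X + ∑ a, ξ a X • Z a) :
    A ∘ₗ A ∘ₗ A + A = 0 ∧
    A ∘ₗ p = p ∘ₗ A.dualMap ∧
    LinearMap.range p ≤ LinearMap.range A ∧
    LinearMap.range A = ⨅ a, LinearMap.ker (ξ a) ∧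
    LinearMap.ker A = Submodule.span ℝ (Set.range Z) ∧
    Phi A p ∘ₗ Phi A p ∘ₗ Phi A p + Phi A p = 0 := by
  have hA3 : ∀ X, A (A (A X)) = -A X := fun X => by
    simp [hA2 X, map_sum, hAZ]
  have hAp : ∀ α, A (p α) = p (A.dualMap α) := fun α => by
    refine (Module.forall_dual_apply_eq_zero_iff ℝ _).mp (fun β => ?_) |> sub_eq_zero.mp
    rw [map_sub, hπA, LinearMap.dualMap_apply, sub_self]
  have hξp : ∀ a α, ξ a (p α) = 0 := fun a α => by
    rw [hskew, hpξ, map_zero, neg_zero]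
  have hrange : LinearMap.range A = ⨅ a, LinearMap.ker (ξ a) := by
    ext X
    simp only [LinearMap.mem_range, Submodule.mem_iInf, LinearMap.mem_ker]
    constructor
    · rintro ⟨Y, rfl⟩ a
      rw [← LinearMap.dualMap_apply, hAξ, LinearMap.zero_apply]
    · intro hX
      exact ⟨-A X, by simp [hA2, hX]⟩
  have hA2p : ∀ α, p (A.dualMap (A.dualMap α)) = -p α := fun α => by
    rw [← hAp, ← hAp, hA2]
    simp [hξp]
  refine ⟨?_, ?_, ?_, hrange, ?_, ?_⟩
  · ext X
    simp [hA3]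
  · exact LinearMap.ext hAp
  · rw [hrange]
    rintro _ ⟨α, rfl⟩
    simp [hξp]
  · apply le_antisymm
    · intro X hX
      have hsum : X = ∑ a, ξ a X • Z a := by
        have h2 := hA2 X
        rw [LinearMap.mem_ker.mp hX, map_zero] at h2
        exact (neg_add_eq_zero.mp h2.symm)
      rw [hsum]
      exact Submodule.sum_mem _ fun a _ =>
        Submodule.smul_mem _ _ (Submodule.subset_span ⟨a, rfl⟩)
    · rw [Submodule.span_le]
      rintro _ ⟨a, rfl⟩
      exact hAZ a
  · refine LinearMap.ext fun ⟨X, α⟩ => Prod.ext ?_ ?_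
    · simp [Phi, hA3, hAp, hA2p]
      abel
    · refine LinearMap.ext fun Y => ?_
      simp [Phi, LinearMap.dualMap_apply, hA3]
end
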